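/- arXiv:gr-qc/0207110 — 3 statements merged into one kernel-verified Lean document; each statement's English description precedes it below -/
import Mathlib

section
/- (Corollary 1 of the paper, pointwise/linear form.) Let n ≥ 2 and let φ : V ≃ V be a linear equivalence of n-dimensional Minkowski vector space. Then φ is a causal relation (φ x ∈ Θ⁺ for all x ∈ Θ⁺) if and only if the pullback bilinear form (x, y) ↦ η (φ x) (φ y) has the dominant property (lies in DP⁺_2) and there exists at least one X ∈ Θ⁺ with φ X ∈ Θ⁺. -/
namespace PaperCausal

variable {n : ℕ}

/-- The Lorentzian (Minkowski) bilinear form on `Fin n → ℝ`: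
`η x y = x 0 * y 0 - ∑_{i ≠ 0} x i * y i`. -/
noncomputable def eta [NeZero n] (x y : Fin n → ℝ) : ℝ :=
  x 0 * y 0 - ∑ i ∈ Finset.univ.filter (fun i => i ≠ (0 : Fin n)), x i * y i

/-- `x ∈ Θ⁺`: future-directed causal vector. -/
def FutureCausal [NeZero n] (x : Fin n → ℝ) : Prop :=
  0 ≤ eta x x ∧ 0 < x 0

/-- Future-directed null vector. -/
def FutureNull [NeZero n] (x : Fin n → ℝ) : Prop :=
  eta x x = 0 ∧ 0 < x 0

/-- Future-directed timelike vector. -/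
def FutureTimelike [NeZero n] (x : Fin n → ℝ) : Prop :=
  0 < eta x x ∧ 0 < x 0

/-- The dominant property `T ∈ DP⁺_r` for an `r`-multilinear map. -/
def DPplus [NeZero n] {r : ℕ} (T : MultilinearMap ℝ (fun _ : Fin r => (Fin n → ℝ)) ℝ) : Prop :=
  ∀ v : Fin r → (Fin n → ℝ), (∀ i, FutureCausal (v i)) → 0 ≤ T v

/-- The dominant property `T ∈ DP⁺_2` for a bilinear form. -/
def DP2 [NeZero n] (T : (Fin n → ℝ) →ₗ[ℝ] (Fin n → ℝ) →ₗ[ℝ] ℝ) : Prop :=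
  ∀ u v : Fin n → ℝ, FutureCausal u → FutureCausal v → 0 ≤ T u v

/-- The reverse-direction Cauchy–Schwarz consequence: two future-directed causal vectors have
nonnegative product. -/
theorem FutureCausal.eta_nonneg [NeZero n] {x y : Fin n → ℝ} (hx : FutureCausal x)
    (hy : FutureCausal y) : 0 ≤ eta x y := by
  obtain ⟨hx, hx0⟩ := hx
  obtain ⟨hy, hy0⟩ := hy
  unfold eta at *
  have hcs := Finset.sum_mul_sq_le_sq_mul_sq
    (Finset.univ.filter (fun i => i ≠ (0 : Fin n))) x y
  simp only [pow_two (x _), pow_two (y _)] at hcs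
  refine sub_nonneg.2 (abs_le_of_sq_le_sq' ?_ (mul_pos hx0 hy0).le).2
  calc _ ≤ _ := hcs
    _ ≤ (x 0 * x 0) * (y 0 * y 0) :=
      mul_le_mul (sub_nonneg.1 hx) (sub_nonneg.1 hy)
        (Finset.sum_nonneg fun i _ => mul_self_nonneg _) (mul_self_nonneg _)
    _ = (x 0 * y 0) ^ 2 := by ring

theorem eta_add_smul_self [NeZero n] (a b : ℝ) (x y : Fin n → ℝ) :
    eta (a • x + b • y) (a • x + b • y) =
      a ^ 2 * eta x x + 2 * (a * b) * eta x y + b ^ 2 * eta y y := by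
  have hsum : ∑ i ∈ Finset.univ.filter (fun i => i ≠ (0 : Fin n)),
        (a * x i + b * y i) * (a * x i + b * y i) =
      a ^ 2 * ∑ i ∈ Finset.univ.filter (fun i => i ≠ (0 : Fin n)), x i * x i +
      2 * (a * b) * ∑ i ∈ Finset.univ.filter (fun i => i ≠ (0 : Fin n)), x i * y i +
      b ^ 2 * ∑ i ∈ Finset.univ.filter (fun i => i ≠ (0 : Fin n)), y i * y i := by
    simp only [Finset.mul_sum, ← Finset.sum_add_distrib]
    exact Finset.sum_congr rfl fun i _ => by ring
  simp only [eta, Pi.add_apply, Pi.smul_apply, smul_eq_mul, hsum]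
  ring

theorem FutureCausal.add_smul [NeZero n] {x y : Fin n → ℝ} (hx : FutureCausal x)
    (hy : FutureCausal y) {a b : ℝ} (ha : 0 ≤ a) (hb : 0 < b) :
    FutureCausal (a • x + b • y) := by
  refine ⟨?_, ?_⟩
  · rw [eta_add_smul_self]
    have hxy := hx.eta_nonneg hy
    have hxx := hx.1
    have hyy := hy.1
    positivity
  · have hx0 := hx.2
    have hy0 := hy.2
    simp only [Pi.add_apply, Pi.smul_apply, smul_eq_mul]
    positivity

theorem eq_zero_of_eta_self_nonneg [NeZero n] {x : Fin n → ℝ} (hx : 0 ≤ eta x x)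
    (hx0 : x 0 = 0) : x = 0 := by
  have hsum : ∑ i ∈ Finset.univ.filter (fun i => i ≠ (0 : Fin n)), x i * x i = 0 := by
    refine le_antisymm ?_ (Finset.sum_nonneg fun i _ => mul_self_nonneg _)
    simpa [eta, hx0] using hx
  rw [Finset.sum_eq_zero_iff_of_nonneg fun i _ => mul_self_nonneg _] at hsum
  funext i
  by_cases hi : i = 0
  · simpa [hi] using hx0
  · simpa using hsum i (by simpa using hi)

theorem futureCausal_single_zero [NeZero n] : FutureCausal (Pi.single (0 : Fin n) (1 : ℝ)) := by
  have hsum : ∑ i ∈ Finset.univ.filter (fun i => i ≠ (0 : Fin n)),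
      (Pi.single (0 : Fin n) (1 : ℝ) : Fin n → ℝ) i * (Pi.single (0 : Fin n) (1 : ℝ) :
        Fin n → ℝ) i = 0 :=
    Finset.sum_eq_zero fun i hi => by simp [(Finset.mem_filter.1 hi).2]
  exact ⟨by simp only [eta, hsum]; simp, by simp⟩

theorem corollary1_pullback (n : ℕ) [NeZero n] (hn : 2 ≤ n)
    (φ : (Fin n → ℝ) ≃ₗ[ℝ] (Fin n → ℝ)) :
    (∀ x : Fin n → ℝ, FutureCausal x → FutureCausal (φ x)) ↔
      ((∀ x y : Fin n → ℝ, FutureCausal x → FutureCausal y → 0 ≤ eta (φ x) (φ y)) ∧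
       ∃ X : Fin n → ℝ, FutureCausal X ∧ FutureCausal (φ X)) := by
  constructor
  · intro h
    exact ⟨fun x y hx hy => (h x hx).eta_nonneg (h y hy),
      _, futureCausal_single_zero, h _ futureCausal_single_zero⟩
  · rintro ⟨h, X, hX, hφX⟩ x hx
    refine ⟨h x x hx hx, ?_⟩
    by_contra! hneg
    have hy := hX.add_smul hx (neg_nonneg.2 hneg) hφX.2
    have hφy := eq_zero_of_eta_self_nonneg (h _ _ hy hy) (by simp; ring)
    have hy0 := hy.2
    rw [φ.map_eq_zero_iff.1 hφy] at hy0
    exact lt_irrefl _ hy0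

end PaperCausal
end

section
/- (Corollary 2 of the paper, pointwise/linear form: it suffices to check causal relations on null vectors.) Let n ≥ 2 and let φ : V ≃ V be a linear equivalence of n-dimensional Minkowski vector space. Then φ is a causal relation (φ x ∈ Θ⁺ for all x ∈ Θ⁺) if and only if φ k ∈ Θ⁺ for every future-directed null vector k. -/
namespace PaperCausal

variable {n : ℕ}

theorem eta_add_left [NeZero n] (x y z : Fin n → ℝ) : eta (x + y) z = eta x z + eta y z := by
  simp only [eta, Pi.add_apply, add_mul, Finset.sum_add_distrib]
  ring

theorem eta_smul_left [NeZero n] (c : ℝ) (x y : Fin n → ℝ) : eta (c • x) y = c * eta x y := by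
  simp only [eta, Pi.smul_apply, smul_eq_mul, mul_assoc, ← Finset.mul_sum, mul_sub]

theorem eta_comm [NeZero n] (x y : Fin n → ℝ) : eta x y = eta y x := by
  simp only [eta, mul_comm]

theorem eta_add_self [NeZero n] (x y : Fin n → ℝ) :
    eta (x + y) (x + y) = eta x x + 2 * eta x y + eta y y := by
  rw [eta_add_left, eta_comm x, eta_comm y, eta_add_left, eta_add_left, eta_comm y x]
  ring

theorem eta_smul_self [NeZero n] (c : ℝ) (x : Fin n → ℝ) :
    eta (c • x) (c • x) = c ^ 2 * eta x x := by
  rw [eta_smul_left, eta_comm, eta_smul_left]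
  ring

theorem FutureCausal.add [NeZero n] {x y : Fin n → ℝ}
    (hx : FutureCausal x) (hy : FutureCausal y) : FutureCausal (x + y) := by
  refine ⟨?_, add_pos hx.2 hy.2⟩
  rw [eta_add_self]
  linarith [hx.1, hy.1, hx.eta_nonneg hy]

theorem FutureCausal.smul [NeZero n] {x : Fin n → ℝ} (hx : FutureCausal x) {c : ℝ}
    (hc : 0 < c) : FutureCausal (c • x) := by
  refine ⟨?_, mul_pos hc hx.2⟩
  rw [eta_smul_self]
  exact mul_nonneg (sq_nonneg c) hx.1

theorem exists_unit_spacelike [NeZero n] (hn : 2 ≤ n) :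
    ∃ e : Fin n → ℝ, eta e e = -1 ∧ e 0 = 0 := by
  have h : (⟨1, hn⟩ : Fin n) ≠ 0 := by simp [Fin.ext_iff]
  refine ⟨Pi.single ⟨1, hn⟩ 1, ?_, Pi.single_eq_of_ne h.symm 1⟩
  simp [eta, Pi.single_apply, h, h.symm]

/-- A future-directed timelike vector is a positive combination of two future-directed null
vectors. -/
theorem FutureTimelike.exists_null_decomposition [NeZero n] (hn : 2 ≤ n) {x : Fin n → ℝ}
    (hx : FutureTimelike x) :
    ∃ (a b : ℝ) (k l : Fin n → ℝ), 0 < a ∧ 0 < b ∧ FutureNull k ∧ FutureNull l ∧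
      x = a • k + b • l := by
  obtain ⟨e, he, he0⟩ := exists_unit_spacelike hn
  obtain ⟨hx, hx0⟩ := hx
  set b := eta x e with hb
  set s := √(b ^ 2 + eta x x)
  have hss : s ^ 2 = b ^ 2 + eta x x := Real.sq_sqrt (by positivity)
  have hbs : |b| < s := Real.lt_sqrt_of_sq_lt (by rw [sq_abs]; linarith)
  obtain ⟨h₁, h₂⟩ := abs_lt.mp hbs
  have hpos : 0 < s := (abs_nonneg b).trans_lt hbs
  have hnull : ∀ t : ℝ, (t - b) ^ 2 = s ^ 2 → FutureNull (x + t • e) := fun t ht => by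
    refine ⟨?_, by simpa [he0] using hx0⟩
    rw [eta_add_self, eta_smul_self, he, eta_comm x (t • e), eta_smul_left, eta_comm e, ← hb]
    linarith
  refine ⟨(s - b) / (2 * s), (s + b) / (2 * s), x + (b + s) • e, x + (b - s) • e,
    div_pos (by linarith) (by linarith), div_pos (by linarith) (by linarith),
    hnull _ (by ring), hnull _ (by ring), ?_⟩
  ext i
  simp only [Pi.add_apply, Pi.smul_apply, smul_eq_mul]
  field_simp
  ring

theorem corollary2_null_suffices (n : ℕ) [NeZero n] (hn : 2 ≤ n)
    (φ : (Fin n → ℝ) ≃ₗ[ℝ] (Fin n → ℝ)) :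
    (∀ x : Fin n → ℝ, FutureCausal x → FutureCausal (φ x)) ↔
      (∀ k : Fin n → ℝ, FutureNull k → FutureCausal (φ k)) := by
  refine ⟨fun h k hk => h k ⟨hk.1.ge, hk.2⟩, fun h x hx => ?_⟩
  rcases hx.1.eq_or_lt with h0 | hpos
  · exact h x ⟨h0.symm, hx.2⟩
  · obtain ⟨a, b, k, l, ha, hb, hk, hl, rfl⟩ :=
      FutureTimelike.exists_null_decomposition hn ⟨hpos, hx.2⟩
    rw [map_add, map_smul, map_smul]
    exact ((h k hk).smul ha).add ((h l hl).smul hb)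

end PaperCausal
end

section
/- (Consequence of the canonical decomposition theorem used in the proof of Theorem 3: a dominant-property tensor with n independent null eigenvectors is proportional to the metric.) Let n ≥ 2 and let T be a symmetric bilinear form on n-dimensional Minkowski vector space with the dominant property (T ∈ DP⁺_2). If there exist n linearly independent vectors k₁, ..., k_n each of which is a null eigenvector of T, then there exists λ ≥ 0 such that T(x, y) = λ * η x y for all x, y ∈ V. -/
namespace PaperCausal

variable {n : ℕ}

theorem eta_add_right [NeZero n] (x y z : Fin n → ℝ) : eta x (y + z) = eta x y + eta x z := by
  simp only [eta, Pi.add_apply, mul_add, Finset.sum_add_distrib]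
  ring

theorem eta_smul_right [NeZero n] (c : ℝ) (x y : Fin n → ℝ) : eta x (c • y) = c * eta x y := by
  simp only [eta, Pi.smul_apply, smul_eq_mul, mul_sub, Finset.mul_sum]
  simp only [mul_left_comm]

theorem eta_zero_right [NeZero n] (x : Fin n → ℝ) : eta x 0 = 0 := by
  simp [eta]

theorem eta_single_zero [NeZero n] :
    eta (Pi.single 0 1 : Fin n → ℝ) (Pi.single 0 1) = 1 := by
  have h : ∑ i ∈ Finset.univ.filter (fun i => i ≠ (0 : Fin n)),
      (Pi.single 0 1 : Fin n → ℝ) i * (Pi.single 0 1 : Fin n → ℝ) i = 0 :=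
    Finset.sum_eq_zero fun i hi => by simp [(Finset.mem_filter.mp hi).2]
  simp [eta, h]

/-- A null vector with vanishing time component is zero. -/
theorem eq_zero_of_null_of_time_eq_zero [NeZero n] {x : Fin n → ℝ} (hx : eta x x = 0)
    (h0 : x 0 = 0) : x = 0 := by
  have h : ∑ i ∈ Finset.univ.filter (fun i => i ≠ (0 : Fin n)), x i * x i = 0 := by
    simpa [eta, h0] using hx
  rw [Finset.sum_eq_zero_iff_of_nonneg fun i _ => mul_self_nonneg _] at h
  funext i
  by_cases hi : i = 0
  · simp [hi, h0]
  · simpa using h i (by simp [hi])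

/-- Orthogonal null vectors are proportional. -/
theorem smul_eq_smul_of_null_of_orthogonal [NeZero n] {x y : Fin n → ℝ} (hx : eta x x = 0)
    (hy : eta y y = 0) (hxy : eta x y = 0) : y 0 • x = x 0 • y := by
  have hz : eta (y 0 • x + (-x 0) • y) (y 0 • x + (-x 0) • y) = 0 := by
    rw [eta_add_right, eta_smul_right, eta_smul_right, eta_comm _ x, eta_comm _ y]
    simp only [eta_add_right, eta_smul_right, eta_comm y x, hx, hy, hxy]
    ring
  have h := eq_zero_of_null_of_time_eq_zero hz (by simp; ring)
  rwa [neg_smul, ← sub_eq_add_neg, sub_eq_zero] at h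

/-- Linearly independent null vectors are not orthogonal. -/
theorem eta_ne_zero_of_null_of_linearIndependent [NeZero n] {x y : Fin n → ℝ}
    (hx : eta x x = 0) (hy : eta y y = 0) (hli : LinearIndependent ℝ ![x, y]) :
    eta x y ≠ 0 := by
  intro hxy
  have h := smul_eq_smul_of_null_of_orthogonal hx hy hxy
  have h0 := LinearIndependent.pair_iff.mp hli (y 0) (-x 0) (by rw [h]; simp)
  exact hli.ne_zero 1 (by simpa using eq_zero_of_null_of_time_eq_zero hy h0.1)

theorem n_null_eigenvectors_metric (n : ℕ) [NeZero n] (hn : 2 ≤ n)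
    (T : (Fin n → ℝ) →ₗ[ℝ] (Fin n → ℝ) →ₗ[ℝ] ℝ)
    (hsymm : ∀ x y : Fin n → ℝ, T x y = T y x) (hT : DP2 T)
    (k : Fin n → (Fin n → ℝ)) (hindep : LinearIndependent ℝ k)
    (hnull : ∀ i : Fin n, eta (k i) (k i) = 0 ∧ k i ≠ 0 ∧
      ∃ l : ℝ, ∀ y : Fin n → ℝ, T y (k i) = l * eta y (k i)) :
    ∃ l : ℝ, 0 ≤ l ∧ ∀ x y : Fin n → ℝ, T x y = l * eta x y := by
  choose hk _ l hl using hnull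
  have hpair : ∀ i j, i ≠ j → l i = l j := by
    intro i j hij
    have hli : LinearIndependent ℝ ![k j, k i] := by
      have hinj : Function.Injective ![j, i] := by
        intro a b hab
        fin_cases a <;> fin_cases b <;> simp_all
      convert hindep.comp _ hinj using 1
      funext a
      fin_cases a <;> rfl
    have hne := eta_ne_zero_of_null_of_linearIndependent (hk j) (hk i) hli
    have h := hl i (k j)
    rw [hsymm, hl j (k i), eta_comm (k i)] at h
    exact (mul_right_cancel₀ hne h).symm
  have hconst : ∀ i, l i = l 0 := fun i => by
    by_cases hi : i = 0
    · rw [hi]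
    · exact hpair i 0 hi
  have hspan := hindep.span_eq_top_of_card_eq_finrank' (by simp)
  have hmetric : ∀ x y, T x y = l 0 * eta x y := by
    intro x y
    have hy : y ∈ Submodule.span ℝ (Set.range k) := hspan ▸ Submodule.mem_top
    induction hy using Submodule.span_induction with
    | mem y hy =>
      obtain ⟨i, rfl⟩ := hy
      rw [hl, hconst]
    | zero => simp [eta_zero_right]
    | add y z _ _ hy hz => rw [map_add, hy, hz, eta_add_right, mul_add]
    | smul c y _ hy => rw [map_smul, hy, eta_smul_right, smul_eq_mul, mul_left_comm]
  have he : FutureCausal (Pi.single 0 1 : Fin n → ℝ) :=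
    ⟨by rw [eta_single_zero]; exact zero_le_one, by simp⟩
  refine ⟨l 0, ?_, hmetric⟩
  simpa [hmetric, eta_single_zero] using hT _ _ he he

end PaperCausal
end
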